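/- Let X ⊆ ℝⁿ be an open set, let 𝒩 be a continuous round cone family on X, let Z ⊆ X be an 𝒩-lens, let 𝒰 be a family of open subsets of X covering the closure of Z in X, and let Z′₁, …, Z′_k ⊆ X be finitely many 𝒩-lenses. Then there exists an 𝒩-special partition {Z_α} of Z such that each Z_α is contained in some member of 𝒰 and, for each i and each α, either Z_α ⊆ Z′_i or Z_α ∩ Z′_i = ∅ (i.e., {Z_α} refines each of the partitions {Z ∩ Z′_i, Z ∖ Z′_i}). -/

import Mathlib

open Set

noncomputable section

/-- `ℝⁿ`. -/
abbrev Euc (n : ℕ) : Type := EuclideanSpace ℝ (Fin n)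

/-- A round cone in `ℝⁿ`: a closed convex set, stable under nonnegative scalar
multiplication, with nonempty interior, satisfying `N ∩ (-N) = {0}`. -/
def IsRoundCone {n : ℕ} (N : Set (Euc n)) : Prop :=
  IsClosed N ∧ Convex ℝ N ∧ (∀ c : ℝ, 0 ≤ c → ∀ v ∈ N, c • v ∈ N) ∧
    (interior N).Nonempty ∧ N ∩ (-N) = {0}

/-- The fiber `𝒩ₓ` of a cone family at a point `x`. -/
def coneFiber {n : ℕ} (𝒩 : Set (Euc n × Euc n)) (x : Euc n) : Set (Euc n) :=
  {v | (x, v) ∈ 𝒩}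

/-- Restriction `𝒩_V := 𝒩 ∩ (V × ℝⁿ)` of a cone family to a subset `V`. -/
def coneRestrict {n : ℕ} (𝒩 : Set (Euc n × Euc n)) (V : Set (Euc n)) :
    Set (Euc n × Euc n) :=
  𝒩 ∩ (V ×ˢ (univ : Set (Euc n)))

/-- A continuous round cone family on `X ⊆ ℝⁿ`. -/
structure IsConeFam {n : ℕ} (X : Set (Euc n)) (𝒩 : Set (Euc n × Euc n)) : Prop where
  subset : 𝒩 ⊆ X ×ˢ (univ : Set (Euc n))
  closed : ∃ C : Set (Euc n × Euc n), IsClosed C ∧ 𝒩 = C ∩ (X ×ˢ (univ : Set (Euc n)))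
  cone : ∀ x ∈ X, IsRoundCone (coneFiber 𝒩 x)
  lsc : ∀ x ∈ X, ∀ v ∈ interior (coneFiber 𝒩 x),
    ∃ V : Set (Euc n), IsOpen V ∧ x ∈ V ∧ V ⊆ X ∧ ∀ y ∈ V, v ∈ interior (coneFiber 𝒩 y)

/-- A C¹ arc in `X`, given by `γ` together with its derivative `γ'` on `[0,1]`. -/
structure IsC1ArcIn {n : ℕ} (X : Set (Euc n)) (γ γ' : ℝ → Euc n) : Prop where
  maps : ∀ t ∈ Icc (0:ℝ) 1, γ t ∈ X
  deriv : ∀ t ∈ Icc (0:ℝ) 1, HasDerivWithinAt γ (γ' t) (Icc (0:ℝ) 1) t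
  cont : ContinuousOn γ' (Icc (0:ℝ) 1)

/-- `P ⊆ X` is `𝒩`-invariant: every C¹ arc starting in `P` whose velocity lies in
`𝒩_{γ(t)} \ {0}` stays in `P`. -/
def NInvariant {n : ℕ} (X : Set (Euc n)) (𝒩 : Set (Euc n × Euc n))
    (P : Set (Euc n)) : Prop :=
  ∀ γ γ' : ℝ → Euc n, IsC1ArcIn X γ γ' → γ 0 ∈ P →
    (∀ t ∈ Icc (0:ℝ) 1, γ' t ∈ coneFiber 𝒩 (γ t) \ {0}) →
    ∀ t ∈ Icc (0:ℝ) 1, γ t ∈ P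

/-- `𝒩`-open subsets of `X`: open and `𝒩`-invariant. -/
def NOpen {n : ℕ} (X : Set (Euc n)) (𝒩 : Set (Euc n × Euc n)) (U : Set (Euc n)) : Prop :=
  U ⊆ X ∧ IsOpen U ∧ NInvariant X 𝒩 U

/-- An `𝒩`-smooth function on `V`: a C¹ function with `df_x(τ) < 0` for all
`τ ∈ 𝒩ₓ \ {0}`, `x ∈ V`. -/
def NSmoothOn {n : ℕ} (𝒩 : Set (Euc n × Euc n)) (f : Euc n → ℝ) (V : Set (Euc n)) : Prop :=
  ∃ df : Euc n → (Euc n →L[ℝ] ℝ), ContinuousOn df V ∧ (∀ x ∈ V, HasFDerivAt f (df x) x) ∧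
    ∀ x ∈ V, ∀ τ ∈ coneFiber 𝒩 x \ {0}, df x τ < 0

/-- `P` is `𝒩`-small: some open neighborhood of `P` in `X` admits an `𝒩`-smooth function. -/
def NSmall {n : ℕ} (X : Set (Euc n)) (𝒩 : Set (Euc n × Euc n)) (P : Set (Euc n)) : Prop :=
  ∃ (W : Set (Euc n)) (f : Euc n → ℝ), IsOpen W ∧ P ⊆ W ∧ W ⊆ X ∧ NSmoothOn 𝒩 f W

/-- `Z ⊆ X` is `𝒩`-special: every point of the closure of `Z` in `X` has an open
neighborhood `V ⊆ X` on which, for some continuous round cone family `𝒩'` with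
`𝒩_V ⋐ 𝒩'`, the set `Z ∩ V` is locally closed in the `𝒩'`-topology of `V`. -/
def NSpecial {n : ℕ} (X : Set (Euc n)) (𝒩 : Set (Euc n × Euc n)) (Z : Set (Euc n)) : Prop :=
  Z ⊆ X ∧ ∀ x ∈ closure Z ∩ X, ∃ (V : Set (Euc n)) (𝒩' : Set (Euc n × Euc n)),
    IsOpen V ∧ x ∈ V ∧ V ⊆ X ∧ IsConeFam V 𝒩' ∧
    (∀ y ∈ V, coneFiber (coneRestrict 𝒩 V) y \ {0} ⊆ interior (coneFiber 𝒩' y)) ∧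
    ∃ U₁ U₂ : Set (Euc n), NOpen V 𝒩' U₁ ∧ NOpen V 𝒩' U₂ ∧ Z ∩ V = U₁ \ U₂

/-- An `𝒩`-lens: an `𝒩`-special subset whose closure in `X` is compact and `𝒩`-small. -/
def NLens {n : ℕ} (X : Set (Euc n)) (𝒩 : Set (Euc n × Euc n)) (Z : Set (Euc n)) : Prop :=
  NSpecial X 𝒩 Z ∧ IsCompact (closure Z ∩ X) ∧ NSmall X 𝒩 (closure Z ∩ X)

/-- A (finite) partition of a subset `S`: finitely many pairwise disjoint nonempty
subsets with union `S`. -/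
def IsPartitionOf {α : Type*} (S : Set α) (Ps : Set (Set α)) : Prop :=
  Ps.Finite ∧ (∀ A ∈ Ps, A.Nonempty) ∧
    (∀ A ∈ Ps, ∀ B ∈ Ps, A ≠ B → Disjoint A B) ∧ ⋃₀ Ps = S

/-- A partition of `S` comes from a closed filtration: there is a chain
`∅ = F₀ ⊆ … ⊆ F_m = S` of subsets closed in `S` whose nonempty successive
differences are exactly the members of the partition. -/
def ComesFromClosedFiltration {α : Type*} [TopologicalSpace α] (S : Set α)
    (Ps : Set (Set α)) : Prop :=
  ∃ (m : ℕ) (F : ℕ → Set α), F 0 = ∅ ∧ F m = S ∧ (∀ i < m, F i ⊆ F (i + 1)) ∧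
    (∀ i ≤ m, ∃ C : Set α, IsClosed C ∧ F i = C ∩ S) ∧
    Ps = {A | A.Nonempty ∧ ∃ i, 1 ≤ i ∧ i ≤ m ∧ A = F i \ F (i - 1)}

/-- An `𝒩`-special partition of an `𝒩`-lens `Z`: it comes from a closed filtration
of `Z` and each member is an `𝒩`-lens. -/
def NSpecialPartition {n : ℕ} (X : Set (Euc n)) (𝒩 : Set (Euc n × Euc n))
    (Z : Set (Euc n)) (Ps : Set (Set (Euc n))) : Prop :=
  IsPartitionOf Z Ps ∧ ComesFromClosedFiltration Z Ps ∧ ∀ A ∈ Ps, NLens X 𝒩 A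

/-- `𝒩`-constructible subsets: the smallest collection containing all `𝒩`-lenses and
stable under finite unions, intersections and differences. -/
inductive NConstructible {n : ℕ} (X : Set (Euc n)) (𝒩 : Set (Euc n × Euc n)) :
    Set (Euc n) → Prop
  | lens (Z : Set (Euc n)) : NLens X 𝒩 Z → NConstructible X 𝒩 Z
  | union (A B : Set (Euc n)) :
      NConstructible X 𝒩 A → NConstructible X 𝒩 B → NConstructible X 𝒩 (A ∪ B)
  | inter (A B : Set (Euc n)) :
      NConstructible X 𝒩 A → NConstructible X 𝒩 B → NConstructible X 𝒩 (A ∩ B)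
  | diff (A B : Set (Euc n)) :
      NConstructible X 𝒩 A → NConstructible X 𝒩 B → NConstructible X 𝒩 (A \ B)

/-- Membership in `Par^≺(Y)`: a partition of `Y` all of whose members are `𝒩`-lenses. -/
def ParPrec {n : ℕ} (X : Set (Euc n)) (𝒩 : Set (Euc n × Euc n)) (Y : Set (Euc n))
    (Ps : Set (Set (Euc n))) : Prop :=
  IsPartitionOf Y Ps ∧ ∀ A ∈ Ps, NLens X 𝒩 A

/-- The relation `⪯` on `Par^≺(Y)`: `Ps ⪯ Qs` if `Qs` refines `Ps` and for each member
`A` of `Ps` the members of `Qs` contained in `A` form an `𝒩`-special partition of `A`. -/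
def PrecRel {n : ℕ} (X : Set (Euc n)) (𝒩 : Set (Euc n × Euc n))
    (Ps Qs : Set (Set (Euc n))) : Prop :=
  (∀ B ∈ Qs, ∃ A ∈ Ps, B ⊆ A) ∧
    ∀ A ∈ Ps, NSpecialPartition X 𝒩 A {B | B ∈ Qs ∧ B ⊆ A}

/-! ### Partitions coming from closed filtrations -/

/-- `S` has a finite partition which comes from a closed filtration and whose members
satisfy `Q`. -/
def HasFiltration {α : Type*} [TopologicalSpace α] (Q : Set α → Prop) (S : Set α) : Prop :=
  ∃ Ps : Set (Set α), IsPartitionOf S Ps ∧ ComesFromClosedFiltration S Ps ∧ ∀ A ∈ Ps, Q A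

lemma hasFiltration_empty {α : Type*} [TopologicalSpace α] (Q : Set α → Prop) :
    HasFiltration Q ∅ := by
  refine ⟨∅, ⟨finite_empty, by simp, by simp, by simp⟩,
    ⟨0, fun _ => ∅, rfl, rfl, by simp, fun _ _ => ⟨∅, by simp⟩, ?_⟩, by simp⟩
  ext A
  simp only [mem_empty_iff_false, mem_ofPred_eq, false_iff]
  rintro ⟨-, i, h1, h2, -⟩
  omega

lemma hasFiltration_of_prop {α : Type*} [TopologicalSpace α] {Q : Set α → Prop} {S : Set α}
    (hS : Q S) : HasFiltration Q S := by
  rcases S.eq_empty_or_nonempty with rfl | hne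
  · exact hasFiltration_empty Q
  refine ⟨{S}, ⟨finite_singleton S, by simpa using hne, ?_, by simp⟩,
    ⟨1, fun i => if i = 0 then ∅ else S, by simp, by simp, ?_, ?_, ?_⟩, by simpa using hS⟩
  · rintro A rfl B rfl h
    exact absurd rfl h
  · intro i hi
    have : i = 0 := by omega
    simp [this]
  · intro i _
    by_cases h : i = 0
    · exact ⟨∅, by simp [h]⟩
    · exact ⟨univ, by simp [h]⟩
  · ext A
    simp only [mem_singleton_iff, mem_ofPred_eq]
    constructor
    · rintro rfl
      exact ⟨hne, 1, le_rfl, le_rfl, by simp⟩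
    · rintro ⟨-, i, h1, h2, rfl⟩
      have : i = 1 := by omega
      simp [this]

lemma ComesFromClosedFiltration.split {α : Type*} [TopologicalSpace α] {S G : Set α}
    (hG : IsOpen G) {P₁ P₂ : Set (Set α)} (h₁ : ComesFromClosedFiltration (S ∩ G) P₁)
    (h₂ : ComesFromClosedFiltration (S \ G) P₂) :
    ComesFromClosedFiltration S (P₁ ∪ P₂) := by
  obtain ⟨m₁, F₁, h0, hm, hmono, hcl, rfl⟩ := h₁
  obtain ⟨m₂, F₂, h0', hm', hmono', hcl', rfl⟩ := h₂
  have hsub : ∀ i ≤ m₁, F₁ i ⊆ S ∩ G := fun i hi => by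
    obtain ⟨C, -, hC⟩ := hcl i hi
    rw [hC]
    exact inter_subset_right
  have hsub' : ∀ i ≤ m₂, F₂ i ⊆ S \ G := fun i hi => by
    obtain ⟨C, -, hC⟩ := hcl' i hi
    rw [hC]
    exact inter_subset_right
  set F : ℕ → Set α := fun i => if i ≤ m₂ then F₂ i else (S \ G) ∪ F₁ (i - m₂) with hF
  have hlow : ∀ i ≤ m₂, F i = F₂ i := fun i hi => by simp [hF, hi]
  have hhigh : ∀ j, F (m₂ + j) = (S \ G) ∪ F₁ j := fun j => by
    rcases Nat.eq_zero_or_pos j with rfl | hj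
    · simp [hF, h0, hm']
    · simp [hF, hj.ne']
  have hdiff : ∀ j, 1 ≤ j → j ≤ m₁ → F (m₂ + j) \ F (m₂ + j - 1) = F₁ j \ F₁ (j - 1) := by
    intro j hj hj1
    rw [Nat.add_sub_assoc hj, hhigh, hhigh]
    ext x
    have := @hsub j hj1 x
    simp only [mem_sdiff, mem_union, mem_inter_iff] at *
    tauto
  refine ⟨m₂ + m₁, F, by rw [hlow 0 (Nat.zero_le _), h0'], ?_, ?_, ?_, ?_⟩
  · rw [hhigh, hm, union_comm, inter_union_sdiff]
  · intro i hi
    by_cases h : i < m₂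
    · rw [hlow i h.le, hlow (i + 1) h]
      exact hmono' i h
    · obtain ⟨j, rfl⟩ := Nat.exists_eq_add_of_le (not_lt.1 h)
      rw [hhigh, add_assoc, hhigh]
      exact union_subset_union_right _ (hmono j (by omega))
  · intro i hi
    by_cases h : i ≤ m₂
    · obtain ⟨C, hC, hC'⟩ := hcl' i h
      refine ⟨C \ G, hC.sdiff hG, ?_⟩
      rw [hlow i h, hC']
      ext x
      simp only [mem_inter_iff, mem_sdiff]
      tauto
    · obtain ⟨j, rfl⟩ := Nat.exists_eq_add_of_le (not_le.1 h).le
      obtain ⟨C, hC, hC'⟩ := hcl j (by omega)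
      refine ⟨Gᶜ ∪ C, hG.isClosed_compl.union hC, ?_⟩
      rw [hhigh, hC']
      ext x
      simp only [mem_union, mem_inter_iff, mem_sdiff, mem_compl_iff]
      tauto
  · ext A
    simp only [mem_union, mem_ofPred_eq]
    constructor
    · rintro (⟨hA, i, h1, h2, rfl⟩ | ⟨hA, i, h1, h2, rfl⟩)
      · exact ⟨hA, m₂ + i, by omega, by omega, (hdiff i h1 h2).symm⟩
      · exact ⟨hA, i, h1, by omega, by rw [hlow i h2, hlow (i - 1) (by omega)]⟩
    · rintro ⟨hA, i, h1, h2, rfl⟩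
      by_cases h : i ≤ m₂
      · exact Or.inr ⟨hA, i, h1, h, by rw [hlow i h, hlow (i - 1) (by omega)]⟩
      · obtain ⟨j, rfl⟩ := Nat.exists_eq_add_of_le (not_le.1 h).le
        exact Or.inl ⟨hA, j, by omega, by omega, hdiff j (by omega) (by omega)⟩

lemma HasFiltration.split {α : Type*} [TopologicalSpace α] {Q : Set α → Prop} {S G : Set α}
    (hG : IsOpen G) (h₁ : HasFiltration Q (S ∩ G)) (h₂ : HasFiltration Q (S \ G)) :
    HasFiltration Q S := by
  obtain ⟨P₁, ⟨hfin₁, hne₁, hdisj₁, hU₁⟩, hF₁, hQ₁⟩ := h₁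
  obtain ⟨P₂, ⟨hfin₂, hne₂, hdisj₂, hU₂⟩, hF₂, hQ₂⟩ := h₂
  have hcross : ∀ A ∈ P₁, ∀ B ∈ P₂, Disjoint A B := fun A hA B hB =>
    (disjoint_sdiff_right.mono_left inter_subset_right : Disjoint (S ∩ G) (S \ G)).mono
      (hU₁ ▸ subset_sUnion_of_mem hA) (hU₂ ▸ subset_sUnion_of_mem hB)
  refine ⟨P₁ ∪ P₂, ⟨hfin₁.union hfin₂, ?_, ?_, ?_⟩, hF₁.split hG hF₂, ?_⟩
  · rintro A (hA | hA)
    exacts [hne₁ A hA, hne₂ A hA]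
  · rintro A (hA | hA) B (hB | hB) hAB
    exacts [hdisj₁ A hA B hB hAB, hcross A hA B hB, (hcross B hB A hA).symm,
      hdisj₂ A hA B hB hAB]
  · rw [sUnion_union, hU₁, hU₂, inter_union_sdiff]
  · rintro A (hA | hA)
    exacts [hQ₁ A hA, hQ₂ A hA]

/-! ### Cone families dominating `𝒩` near a point -/

/-- `𝒩'` is a continuous round cone family on the open neighbourhood `V` of `x` in `X`, with
`𝒩_V ⋐ 𝒩'`. -/
structure Dominates {n : ℕ} (X : Set (Euc n)) (𝒩 : Set (Euc n × Euc n)) (x : Euc n)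
    (V : Set (Euc n)) (𝒩' : Set (Euc n × Euc n)) : Prop where
  isOpen : IsOpen V
  mem : x ∈ V
  subset : V ⊆ X
  isConeFam : IsConeFam V 𝒩'
  dom : ∀ y ∈ V, coneFiber (coneRestrict 𝒩 V) y \ {0} ⊆ interior (coneFiber 𝒩' y)

/-- `G` is open near `x` for the topology of some cone family dominating `𝒩`. -/
def LocNOpen {n : ℕ} (X : Set (Euc n)) (𝒩 : Set (Euc n × Euc n)) (x : Euc n)
    (G : Set (Euc n)) : Prop :=
  ∃ (V : Set (Euc n)) (𝒩' : Set (Euc n × Euc n)), Dominates X 𝒩 x V 𝒩' ∧ NOpen V 𝒩' (G ∩ V)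

/-- `Y` is locally closed near `x` for the topology of some cone family dominating `𝒩`. -/
def LocSpecial {n : ℕ} (X : Set (Euc n)) (𝒩 : Set (Euc n × Euc n)) (x : Euc n)
    (Y : Set (Euc n)) : Prop :=
  ∃ (V : Set (Euc n)) (𝒩' : Set (Euc n × Euc n)), Dominates X 𝒩 x V 𝒩' ∧
    ∃ U₁ U₂ : Set (Euc n), NOpen V 𝒩' U₁ ∧ NOpen V 𝒩' U₂ ∧ Y ∩ V = U₁ \ U₂

section

variable {n : ℕ} {X V : Set (Euc n)} {𝒩 𝒩' : Set (Euc n × Euc n)} {x : Euc n}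

lemma coneFiber_coneRestrict {y : Euc n} (hy : y ∈ V) :
    coneFiber (coneRestrict 𝒩 V) y = coneFiber 𝒩 y := by
  ext v
  simp [coneFiber, coneRestrict, hy]

lemma IsConeFam.zero_mem (h : IsConeFam X 𝒩) {y : Euc n} (hy : y ∈ X) :
    (0 : Euc n) ∈ coneFiber 𝒩 y := by
  have h0 := (h.cone y hy).2.2.2.2
  have : (0 : Euc n) ∈ coneFiber 𝒩 y ∩ -coneFiber 𝒩 y := by simp [h0]
  exact this.1

lemma IsConeFam.exists_ne_zero [Nontrivial (Euc n)] (h : IsConeFam X 𝒩) {y : Euc n}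
    (hy : y ∈ X) : (coneFiber 𝒩 y \ {0}).Nonempty := by
  obtain ⟨w, hw⟩ := (h.cone y hy).2.2.2.1
  have : (nhdsWithin w {w}ᶜ).NeBot := Module.punctured_nhds_neBot ℝ (Euc n) w
  obtain ⟨v, hv, hv0⟩ :=
    (infinite_of_mem_nhds w (isOpen_interior.mem_nhds hw)).nontrivial.exists_ne 0
  exact ⟨v, interior_subset hv, hv0⟩

lemma NSpecial.locSpecial {Z : Set (Euc n)} (hZ : NSpecial X 𝒩 Z) (hx : x ∈ closure Z ∩ X) :
    LocSpecial X 𝒩 x Z := by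
  obtain ⟨V, 𝒩', h1, h2, h3, h4, h5, h6⟩ := hZ.2 x hx
  exact ⟨V, 𝒩', ⟨h1, h2, h3, h4, h5⟩, h6⟩

lemma NOpen.restrict {V' U : Set (Euc n)} {𝒩'' : Set (Euc n × Euc n)} (hU : NOpen V 𝒩' U)
    (hV' : IsOpen V') (hsub : V' ⊆ V) (h𝒩 : 𝒩'' ⊆ 𝒩') : NOpen V' 𝒩'' (U ∩ V') := by
  refine ⟨inter_subset_right, hU.2.1.inter hV', fun γ γ' hγ h0 hd t ht => ⟨?_, hγ.maps t ht⟩⟩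
  exact hU.2.2 γ γ' ⟨fun s hs => hsub (hγ.maps s hs), hγ.deriv, hγ.cont⟩ h0.1
    (fun s hs => ⟨h𝒩 (hd s hs).1, (hd s hs).2⟩) t ht

lemma NOpen.inter {U₁ U₂ : Set (Euc n)} (h₁ : NOpen V 𝒩' U₁) (h₂ : NOpen V 𝒩' U₂) :
    NOpen V 𝒩' (U₁ ∩ U₂) :=
  ⟨inter_subset_left.trans h₁.1, h₁.2.1.inter h₂.2.1, fun γ γ' hγ h0 hd t ht =>
    ⟨h₁.2.2 γ γ' hγ h0.1 hd t ht, h₂.2.2 γ γ' hγ h0.2 hd t ht⟩⟩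

lemma NOpen.union {U₁ U₂ : Set (Euc n)} (h₁ : NOpen V 𝒩' U₁) (h₂ : NOpen V 𝒩' U₂) :
    NOpen V 𝒩' (U₁ ∪ U₂) :=
  ⟨union_subset h₁.1 h₂.1, h₁.2.1.union h₂.2.1, fun γ γ' hγ h0 hd t ht =>
    h0.imp (fun h => h₁.2.2 γ γ' hγ h hd t ht) (fun h => h₂.2.2 γ γ' hγ h hd t ht)⟩

lemma nOpen_empty : NOpen V 𝒩' ∅ :=
  ⟨empty_subset _, isOpen_empty, fun _ _ _ h0 => h0.elim⟩

lemma LocNOpen.empty {G : Set (Euc n)} (h : LocNOpen X 𝒩 x G) : LocNOpen X 𝒩 x ∅ := by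
  obtain ⟨V, 𝒩', hV, -⟩ := h
  exact ⟨V, 𝒩', hV, by simpa using nOpen_empty⟩

lemma Dominates.inter (h𝒩 : IsConeFam X 𝒩) {V₁ V₂ O : Set (Euc n)}
    {𝒩₁ 𝒩₂ : Set (Euc n × Euc n)} (h₁ : Dominates X 𝒩 x V₁ 𝒩₁) (h₂ : Dominates X 𝒩 x V₂ 𝒩₂)
    (hO : IsOpen O) (hxO : x ∈ O) :
    Dominates X 𝒩 x (V₁ ∩ V₂ ∩ O) (coneRestrict (𝒩₁ ∩ 𝒩₂) (V₁ ∩ V₂ ∩ O)) := by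
  have hopen : IsOpen (V₁ ∩ V₂ ∩ O) := (h₁.isOpen.inter h₂.isOpen).inter hO
  have hfib : ∀ y ∈ V₁ ∩ V₂ ∩ O, coneFiber (coneRestrict (𝒩₁ ∩ 𝒩₂) (V₁ ∩ V₂ ∩ O)) y =
      coneFiber 𝒩₁ y ∩ coneFiber 𝒩₂ y := fun y hy => coneFiber_coneRestrict hy
  have hdom : ∀ y ∈ V₁ ∩ V₂ ∩ O, coneFiber 𝒩 y \ {0} ⊆
      interior (coneFiber 𝒩₁ y ∩ coneFiber 𝒩₂ y) := by
    intro y hy v hv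
    rw [interior_inter]
    refine ⟨h₁.dom y hy.1.1 ?_, h₂.dom y hy.1.2 ?_⟩
    · rwa [coneFiber_coneRestrict hy.1.1]
    · rwa [coneFiber_coneRestrict hy.1.2]
  refine ⟨hopen, ⟨⟨h₁.mem, h₂.mem⟩, hxO⟩, fun y hy => h₁.subset hy.1.1,
    ⟨inter_subset_right, ?_, ?_, ?_⟩, ?_⟩
  · obtain ⟨C₁, hC₁, e₁⟩ := h₁.isConeFam.closed
    obtain ⟨C₂, hC₂, e₂⟩ := h₂.isConeFam.closed
    refine ⟨C₁ ∩ C₂, hC₁.inter hC₂, ?_⟩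
    rw [coneRestrict, e₁, e₂]
    ext p
    simp only [mem_inter_iff, mem_prod, mem_univ, and_true]
    tauto
  · intro y hy
    rw [hfib y hy]
    obtain ⟨c1, c2, c3, -, c5⟩ := h₁.isConeFam.cone y hy.1.1
    obtain ⟨d1, d2, d3, -, d5⟩ := h₂.isConeFam.cone y hy.1.2
    have z₁ := h₁.isConeFam.zero_mem hy.1.1
    have z₂ := h₂.isConeFam.zero_mem hy.1.2
    refine ⟨c1.inter d1, c2.inter d2, fun c hc v hv => ⟨c3 c hc v hv.1, d3 c hc v hv.2⟩, ?_, ?_⟩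
    · rcases subsingleton_or_nontrivial (Euc n) with hs | hn
      · have : coneFiber 𝒩₁ y ∩ coneFiber 𝒩₂ y = univ :=
          Subsingleton.eq_univ_of_nonempty ⟨0, z₁, z₂⟩
        rw [this, interior_univ]
        exact univ_nonempty
      · obtain ⟨v, hv⟩ := h𝒩.exists_ne_zero (h₁.subset hy.1.1)
        exact ⟨v, hdom y hy hv⟩
    · refine Subset.antisymm (fun v hv => ?_) ?_
      · rw [← c5]
        exact ⟨hv.1.1, hv.2.1⟩
      · rintro v rfl
        exact ⟨⟨z₁, z₂⟩, by simpa using ⟨z₁, z₂⟩⟩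
  · intro y hy v hv
    rw [hfib y hy, interior_inter] at hv
    obtain ⟨A, hA, hyA, -, hA'⟩ := h₁.isConeFam.lsc y hy.1.1 v hv.1
    obtain ⟨B, hB, hyB, -, hB'⟩ := h₂.isConeFam.lsc y hy.1.2 v hv.2
    refine ⟨A ∩ B ∩ (V₁ ∩ V₂ ∩ O), (hA.inter hB).inter hopen, ⟨⟨hyA, hyB⟩, hy⟩,
      inter_subset_right, fun z hz => ?_⟩
    rw [hfib z hz.2, interior_inter]
    exact ⟨hA' z hz.1.1, hB' z hz.1.2⟩
  · intro y hy
    rw [coneFiber_coneRestrict hy, hfib y hy]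
    exact hdom y hy

lemma LocSpecial.inter_diff (h𝒩 : IsConeFam X 𝒩) {Y G G' : Set (Euc n)}
    (hY : LocSpecial X 𝒩 x Y) (hG' : LocNOpen X 𝒩 x G')
    (hGG' : ∀ᶠ y in nhds x, y ∈ Y → (y ∈ G' ↔ y ∈ G)) :
    LocSpecial X 𝒩 x (Y ∩ G) ∧ LocSpecial X 𝒩 x (Y \ G) := by
  obtain ⟨V₁, 𝒩₁, h₁, U₁, U₂, hU₁, hU₂, hYU⟩ := hY
  obtain ⟨V₂, 𝒩₂, h₂, hG⟩ := hG'
  obtain ⟨O, hO, hOo, hxO⟩ := eventually_nhds_iff.1 hGG'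
  have hD := h₁.inter h𝒩 h₂ hOo hxO
  have hsub₁ : V₁ ∩ V₂ ∩ O ⊆ V₁ := fun y hy => hy.1.1
  have hsub₂ : V₁ ∩ V₂ ∩ O ⊆ V₂ := fun y hy => hy.1.2
  have hn₁ : coneRestrict (𝒩₁ ∩ 𝒩₂) (V₁ ∩ V₂ ∩ O) ⊆ 𝒩₁ := fun y hy => hy.1.1
  have hn₂ : coneRestrict (𝒩₁ ∩ 𝒩₂) (V₁ ∩ V₂ ∩ O) ⊆ 𝒩₂ := fun y hy => hy.1.2
  have k₁ := hU₁.restrict hD.isOpen hsub₁ hn₁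
  have k₂ := hU₂.restrict hD.isOpen hsub₁ hn₁
  have k₃ := hG.restrict hD.isOpen hsub₂ hn₂
  have key : ∀ y ∈ V₁, y ∈ Y ↔ y ∈ U₁ ∧ y ∉ U₂ := fun y hy => by
    have := Set.ext_iff.1 hYU y
    simpa [hy] using this
  refine ⟨⟨_, _, hD, _, _, k₁.inter k₃, k₂, ?_⟩, ⟨_, _, hD, _, _, k₁, k₂.union k₃, ?_⟩⟩
  all_goals
    ext y
    have a := key y
    have b := hO y
    simp only [mem_inter_iff, mem_sdiff, mem_union] at *
    tauto

/-! ### Smooth functions -/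

/-- Upper semicontinuity of `𝒩`: a linear form negative on `𝒩ₓ ∖ {0}` is uniformly negative
on the nearby fibers. -/
lemma IsConeFam.exists_bound (hX : IsOpen X) (h𝒩 : IsConeFam X 𝒩) (hx : x ∈ X)
    (L : Euc n →L[ℝ] ℝ) (hL : ∀ τ ∈ coneFiber 𝒩 x \ {0}, L τ < 0) :
    ∃ δ > 0, ∀ᶠ y in nhds x, ∀ v ∈ coneFiber 𝒩 y, L v ≤ -(2 * δ) * ‖v‖ := by
  obtain ⟨C, hC, hCe⟩ := h𝒩.closed
  have hS : IsCompact (Metric.sphere (0 : Euc n) 1) := isCompact_sphere _ _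
  have hK : IsCompact (Metric.sphere (0 : Euc n) 1 ∩ coneFiber 𝒩 x) :=
    hS.inter_right (h𝒩.cone x hx).1
  obtain ⟨δ, hδ, hδL⟩ : ∃ δ > 0, ∀ v ∈ Metric.sphere (0 : Euc n) 1 ∩ coneFiber 𝒩 x,
      L v < -(2 * δ) := by
    rcases (Metric.sphere (0 : Euc n) 1 ∩ coneFiber 𝒩 x).eq_empty_or_nonempty with he | hne
    · exact ⟨1, one_pos, by simp [he]⟩
    · obtain ⟨w, hw, hmax⟩ := hK.exists_isMaxOn hne L.continuous.continuousOn
      have hw0 : w ≠ 0 := by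
        rintro rfl
        simpa using hw.1
      have := hL w ⟨hw.2, hw0⟩
      refine ⟨-L w / 4, by linarith, fun v hv => ?_⟩
      have h2 : L v ≤ L w := hmax hv
      linarith
  refine ⟨δ, hδ, ?_⟩
  have hev : ∀ᶠ y in nhds x, ∀ v ∈ Metric.sphere (0 : Euc n) 1,
      (y, v) ∈ Cᶜ ∪ {p : Euc n × Euc n | L p.2 < -(2 * δ)} := by
    refine hS.eventually_forall_of_forall_eventually fun v hv => ?_
    refine (hC.isOpen_compl.union
      (isOpen_lt (L.continuous.comp continuous_snd) continuous_const)).mem_nhds ?_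
    by_cases hvC : (x, v) ∈ C
    · refine Or.inr (hδL v ⟨hv, ?_⟩)
      change (x, v) ∈ 𝒩
      rw [hCe]
      exact ⟨hvC, hx, mem_univ _⟩
    · exact Or.inl hvC
  filter_upwards [hev, hX.mem_nhds hx] with y hy hyX v hv
  rcases eq_or_ne v 0 with rfl | hv0
  · simp
  have hpos : 0 < ‖v‖ := norm_pos_iff.2 hv0
  have hu : ‖v‖⁻¹ • v ∈ coneFiber 𝒩 y :=
    (h𝒩.cone y hyX).2.2.1 _ (inv_nonneg.2 hpos.le) v hv
  have hus : ‖v‖⁻¹ • v ∈ Metric.sphere (0 : Euc n) 1 := by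
    simp [norm_smul, hpos.ne']
  have hlt : L (‖v‖⁻¹ • v) < -(2 * δ) := by
    refine (hy _ hus).resolve_left fun h => h ?_
    have : (y, ‖v‖⁻¹ • v) ∈ 𝒩 := hu
    rw [hCe] at this
    exact this.1
  rw [map_smul, smul_eq_mul, inv_mul_lt_iff₀ hpos] at hlt
  linarith

/-- Negativity of a continuous family of linear forms on `𝒩 ∖ {0}` is an open condition. -/
lemma IsConeFam.eventually_neg (hX : IsOpen X) (h𝒩 : IsConeFam X 𝒩) (hx : x ∈ X)
    {dg : Euc n → (Euc n →L[ℝ] ℝ)} (hdg : ContinuousAt dg x)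
    (hneg : ∀ τ ∈ coneFiber 𝒩 x \ {0}, dg x τ < 0) :
    ∀ᶠ y in nhds x, ∀ τ ∈ coneFiber 𝒩 y \ {0}, dg y τ < 0 := by
  obtain ⟨δ, hδ, hev⟩ := h𝒩.exists_bound hX hx (dg x) hneg
  filter_upwards [hev, Metric.continuousAt_iff'.1 hdg δ hδ] with y hy hd τ hτ
  have hpos : 0 < ‖τ‖ := norm_pos_iff.2 hτ.2
  have h1 := hy τ hτ.1
  have h2 : (dg y - dg x) τ ≤ ‖dg y - dg x‖ * ‖τ‖ :=
    (le_abs_self _).trans ((dg y - dg x).le_opNorm τ)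
  rw [dist_eq_norm] at hd
  rw [_root_.sub_apply] at h2
  nlinarith

/-- The cone of vectors on which `L` is at most `-δ` times the norm. -/
lemma isRoundCone_setOf_le (L : Euc n →L[ℝ] ℝ) {δ : ℝ} (hδ : 0 < δ)
    (hne : (interior {v : Euc n | L v ≤ -δ * ‖v‖}).Nonempty) :
    IsRoundCone {v : Euc n | L v ≤ -δ * ‖v‖} := by
  refine ⟨isClosed_le L.continuous (by fun_prop), ?_, ?_, hne, ?_⟩
  · intro v hv w hw a b ha hb _
    simp only [mem_ofPred_eq, map_add, map_smul, smul_eq_mul] at *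
    have h1 : ‖a • v + b • w‖ ≤ a * ‖v‖ + b * ‖w‖ := by
      refine (norm_add_le _ _).trans_eq ?_
      rw [norm_smul, norm_smul, Real.norm_of_nonneg ha, Real.norm_of_nonneg hb]
    have h2 := mul_le_mul_of_nonneg_left hv ha
    have h3 := mul_le_mul_of_nonneg_left hw hb
    have h4 := mul_le_mul_of_nonneg_left h1 hδ.le
    linarith
  · intro c hc v hv
    simp only [mem_ofPred_eq, map_smul, smul_eq_mul, norm_smul, Real.norm_of_nonneg hc] at *
    have := mul_le_mul_of_nonneg_left hv hc
    linarith
  · refine Subset.antisymm (fun v hv => ?_) ?_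
    · obtain ⟨h1, h2⟩ := hv
      simp only [mem_ofPred_eq, Set.mem_neg, map_neg, norm_neg] at h1 h2
      have : ‖v‖ ≤ 0 := by nlinarith
      simpa using this
    · rintro v rfl
      simp

/-- Sublevel sets of an `𝒩`-smooth function are open for a larger cone family. -/
lemma locNOpen_sublevel (hX : IsOpen X) (h𝒩 : IsConeFam X 𝒩) (hx : x ∈ X)
    {g : Euc n → ℝ} {dg : Euc n → (Euc n →L[ℝ] ℝ)}
    (hg : ∀ᶠ y in nhds x, HasFDerivAt g (dg y) y) (hdg : ContinuousAt dg x)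
    (hneg : ∀ τ ∈ coneFiber 𝒩 x \ {0}, dg x τ < 0) (c : ℝ) :
    LocNOpen X 𝒩 x {y | g y < c} := by
  obtain ⟨δ, hδ, hev⟩ := h𝒩.exists_bound hX hx (dg x) hneg
  obtain ⟨V, hV, hVo, hxV⟩ := eventually_nhds_iff.1
    (hg.and (hev.and ((Metric.continuousAt_iff'.1 hdg δ hδ).and (hX.mem_nhds hx))))
  set N : Set (Euc n) := {v | dg x v ≤ -δ * ‖v‖} with hN
  have hdom : ∀ y ∈ V, coneFiber 𝒩 y \ {0} ⊆ interior N := by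
    intro y hy v hv
    have hsub : {v : Euc n | dg x v < -δ * ‖v‖} ⊆ interior N :=
      interior_maximal (fun w (hw : dg x w < -δ * ‖w‖) => hw.le)
        (isOpen_lt (dg x).continuous (by fun_prop))
    have hpos : 0 < ‖v‖ := norm_pos_iff.2 hv.2
    have := (hV y hy).2.1 v hv.1
    refine hsub ?_
    rw [mem_ofPred_eq]
    nlinarith
  have hfib : ∀ y ∈ V, coneFiber (V ×ˢ N) y = N := fun y hy => by
    ext v
    simp [coneFiber, hy]
  have hround : IsRoundCone N := by
    refine isRoundCone_setOf_le _ hδ ?_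
    rcases subsingleton_or_nontrivial (Euc n) with hs | hn
    · have : {v : Euc n | dg x v ≤ -δ * ‖v‖} = univ :=
        Subsingleton.eq_univ_of_nonempty ⟨0, by simp⟩
      rw [this, interior_univ]
      exact univ_nonempty
    · obtain ⟨v, hv⟩ := h𝒩.exists_ne_zero hx
      exact ⟨v, hdom x hxV hv⟩
  refine ⟨V, V ×ˢ N, ⟨hVo, hxV, fun y hy => (hV y hy).2.2.2, ⟨?_, ?_, ?_, ?_⟩, ?_⟩,
    inter_subset_right, ?_, ?_⟩
  · exact prod_mono_right (subset_univ _)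
  · refine ⟨univ ×ˢ N, isClosed_univ.prod hround.1, ?_⟩
    rw [prod_inter_prod]
    simp
  · intro y hy
    rwa [hfib y hy]
  · intro y hy v hv
    refine ⟨V, hVo, hy, Subset.rfl, fun z hz => ?_⟩
    rw [hfib z hz]
    rwa [hfib y hy] at hv
  · intro y hy
    rw [coneFiber_coneRestrict hy, hfib y hy]
    exact hdom y hy
  · rw [inter_comm]
    exact ContinuousOn.isOpen_inter_preimage
      (fun y hy => (hV y hy).1.continuousAt.continuousWithinAt) hVo isOpen_Iio
  · intro γ γ' hγ h0 hd t ht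
    refine ⟨?_, hγ.maps t ht⟩
    have hder : ∀ s ∈ Icc (0 : ℝ) 1,
        HasDerivWithinAt (g ∘ γ) (dg (γ s) (γ' s)) (Icc (0 : ℝ) 1) s := fun s hs =>
      (hV _ (hγ.maps s hs)).1.comp_hasDerivWithinAt s (hγ.deriv s hs)
    have hanti : AntitoneOn (g ∘ γ) (Icc (0 : ℝ) 1) := by
      refine antitoneOn_of_hasDerivWithinAt_nonpos (f' := fun s => dg (γ s) (γ' s))
        (convex_Icc 0 1) (fun s hs => (hder s hs).continuousWithinAt)
        (fun s hs => (hder s (interior_subset hs)).mono interior_subset) fun s hs => ?_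
      have hs' : s ∈ Icc (0 : ℝ) 1 := interior_subset hs
      have h1 := hd s hs'
      rw [hfib _ (hγ.maps s hs')] at h1
      have h2 : dg x (γ' s) ≤ -δ * ‖γ' s‖ := h1.1
      have h3 := (hV _ (hγ.maps s hs')).2.2.1
      rw [dist_eq_norm] at h3
      have h4 : (dg (γ s) - dg x) (γ' s) ≤ ‖dg (γ s) - dg x‖ * ‖γ' s‖ :=
        (le_abs_self _).trans ((dg (γ s) - dg x).le_opNorm _)
      rw [_root_.sub_apply] at h4
      nlinarith [norm_nonneg (γ' s)]
    exact (hanti (left_mem_Icc.2 zero_le_one) ht ht.1).trans_lt h0.1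

/-! ### Cutting lenses -/

/-- Subsets of `K` which are locally closed, near each point of their closure, for the topology
of some cone family dominating `𝒩`. -/
def Admissible (X : Set (Euc n)) (𝒩 : Set (Euc n × Euc n)) (K Y : Set (Euc n)) : Prop :=
  Y ⊆ K ∧ ∀ x ∈ closure Y, LocSpecial X 𝒩 x Y

/-- Near each point of the closure of `Y`, the trace of `G` on `Y` is the trace of an open set
for the topology of some cone family dominating `𝒩`. -/
def RelNOpen (X : Set (Euc n)) (𝒩 : Set (Euc n × Euc n)) (Y G : Set (Euc n)) : Prop :=
  ∀ x ∈ closure Y, ∃ G', LocNOpen X 𝒩 x G' ∧ ∀ᶠ y in nhds x, y ∈ Y → (y ∈ G' ↔ y ∈ G)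

lemma RelNOpen.mono {Y Y' G : Set (Euc n)} (h : RelNOpen X 𝒩 Y G) (hY : Y' ⊆ Y) :
    RelNOpen X 𝒩 Y' G := fun x hx => by
  obtain ⟨G', hG', hev⟩ := h x (closure_mono hY hx)
  exact ⟨G', hG', hev.mono fun y hy hyY => hy (hY hyY)⟩

lemma Admissible.inter {K Y G : Set (Euc n)} (h𝒩 : IsConeFam X 𝒩) (hY : Admissible X 𝒩 K Y)
    (hG : RelNOpen X 𝒩 Y G) : Admissible X 𝒩 K (Y ∩ G) := by
  refine ⟨inter_subset_left.trans hY.1, fun x hx => ?_⟩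
  have hx' := closure_mono inter_subset_left hx
  obtain ⟨G', hG', hev⟩ := hG x hx'
  exact ((hY.2 x hx').inter_diff h𝒩 hG' hev).1

lemma Admissible.diff {K Y G : Set (Euc n)} (h𝒩 : IsConeFam X 𝒩) (hY : Admissible X 𝒩 K Y)
    (hG : RelNOpen X 𝒩 Y G) : Admissible X 𝒩 K (Y \ G) := by
  refine ⟨sdiff_subset.trans hY.1, fun x hx => ?_⟩
  have hx' := closure_mono sdiff_subset hx
  obtain ⟨G', hG', hev⟩ := hG x hx'
  exact ((hY.2 x hx').inter_diff h𝒩 hG' hev).2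

lemma Admissible.nLens {K Y : Set (Euc n)} (hY : Admissible X 𝒩 K Y) (hK : IsCompact K)
    (hKX : K ⊆ X) (hKs : NSmall X 𝒩 K) : NLens X 𝒩 Y := by
  have hcl : closure Y ⊆ K := closure_minimal hY.1 hK.isClosed
  have hcl' : closure Y ∩ X = closure Y := inter_eq_left.2 (hcl.trans hKX)
  refine ⟨⟨hY.1.trans hKX, fun x hx => ?_⟩, ?_, ?_⟩
  · obtain ⟨V, 𝒩', hD, hU⟩ := hY.2 x hx.1
    exact ⟨V, 𝒩', hD.isOpen, hD.mem, hD.subset, hD.isConeFam, hD.dom, hU⟩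
  · rw [hcl']
    exact hK.of_isClosed_subset isClosed_closure hcl
  · obtain ⟨W, f, h1, h2, h3, h4⟩ := hKs
    exact ⟨W, f, h1, inter_subset_left.trans (hcl.trans h2), h3, h4⟩

/-- `A` is the trace on `O` of a difference of open sets which are locally open for cone
families dominating `𝒩`. -/
def SplitsOn (X : Set (Euc n)) (𝒩 : Set (Euc n × Euc n)) (O A : Set (Euc n)) : Prop :=
  ∃ G₁ G₂ : Set (Euc n), IsOpen G₁ ∧ IsOpen G₂ ∧ (∀ y ∈ O, y ∈ A ↔ y ∈ G₁ ∧ y ∉ G₂) ∧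
    ∀ y ∈ O, LocNOpen X 𝒩 y G₁ ∧ LocNOpen X 𝒩 y G₂

lemma SplitsOn.mono {O O' A : Set (Euc n)} (h : SplitsOn X 𝒩 O A) (hO : O' ⊆ O) :
    SplitsOn X 𝒩 O' A := by
  obtain ⟨G₁, G₂, h1, h2, h3, h4⟩ := h
  exact ⟨G₁, G₂, h1, h2, fun y hy => h3 y (hO hy), fun y hy => h4 y (hO hy)⟩

lemma SplitsOn.of_disjoint {O A : Set (Euc n)} (h : ∀ y ∈ O, y ∉ A)
    (hO : ∀ y ∈ O, LocNOpen X 𝒩 y ∅) : SplitsOn X 𝒩 O A :=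
  ⟨∅, ∅, isOpen_empty, isOpen_empty, fun y hy => by simp [h y hy], fun y hy => ⟨hO y hy, hO y hy⟩⟩

lemma LocSpecial.exists_splitsOn {A : Set (Euc n)} (h : LocSpecial X 𝒩 x A) :
    ∃ O, IsOpen O ∧ x ∈ O ∧ SplitsOn X 𝒩 O A := by
  obtain ⟨V, 𝒩', hD, U₁, U₂, h₁, h₂, hU⟩ := h
  refine ⟨V, hD.isOpen, hD.mem, U₁, U₂, h₁.2.1, h₂.2.1, fun y hy => ?_, fun y hy => ?_⟩
  · have := Set.ext_iff.1 hU y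
    simpa [hy] using this
  · have hD' : Dominates X 𝒩 y V 𝒩' := ⟨hD.isOpen, hy, hD.subset, hD.isConeFam, hD.dom⟩
    refine ⟨⟨V, 𝒩', hD', ?_⟩, ⟨V, 𝒩', hD', ?_⟩⟩
    · rwa [inter_eq_left.2 h₁.1]
    · rwa [inter_eq_left.2 h₂.1]

/-- An admissible set whose closure lies where the sets `A i` split can be filtered compatibly
with the `A i`. -/
lemma hasFiltration_of_splitsOn {ι : Type*} {K O : Set (Euc n)} {A : ι → Set (Euc n)}
    {Q : Set (Euc n) → Prop} (h𝒩 : IsConeFam X 𝒩) (hA : ∀ i, SplitsOn X 𝒩 O (A i))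
    (hQ : ∀ Y, Admissible X 𝒩 K Y → closure Y ⊆ O → (∀ i, Y ⊆ A i ∨ Y ∩ A i = ∅) → Q Y)
    (s : Finset ι) :
    ∀ Y, Admissible X 𝒩 K Y → closure Y ⊆ O → (∀ i ∉ s, Y ⊆ A i ∨ Y ∩ A i = ∅) →
      HasFiltration Q Y := by
  classical
  induction s using Finset.induction_on with
  | empty =>
    intro Y hY hYO hs
    exact hasFiltration_of_prop (hQ Y hY hYO fun i => hs i (Finset.notMem_empty i))
  | insert i s _ ih =>
    intro Y hY hYO hs
    obtain ⟨G₁, G₂, ho₁, ho₂, hG, hloc⟩ := hA i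
    have hr₁ : RelNOpen X 𝒩 Y G₁ := fun x hx =>
      ⟨G₁, (hloc x (hYO hx)).1, Filter.Eventually.of_forall fun _ _ => Iff.rfl⟩
    have hr₂ : RelNOpen X 𝒩 Y G₂ := fun x hx =>
      ⟨G₂, (hloc x (hYO hx)).2, Filter.Eventually.of_forall fun _ _ => Iff.rfl⟩
    have hiff : ∀ y ∈ Y, y ∈ A i ↔ y ∈ G₁ ∧ y ∉ G₂ := fun y hy => hG y (hYO (subset_closure hy))
    have step : ∀ Y' ⊆ Y, Admissible X 𝒩 K Y' → (Y' ⊆ A i ∨ Y' ∩ A i = ∅) →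
        HasFiltration Q Y' := by
      intro Y' hsub hY' hi
      refine ih Y' hY' ((closure_mono hsub).trans hYO) fun j hj => ?_
      rcases eq_or_ne j i with rfl | hji
      · exact hi
      · refine (hs j (by simp [hji, hj])).imp hsub.trans fun h => ?_
        exact subset_empty_iff.1 (h ▸ inter_subset_inter_left _ hsub)
    have hdisj : ∀ Y' : Set (Euc n), (∀ y ∈ Y', y ∉ A i) → Y' ∩ A i = ∅ := fun Y' h =>
      eq_empty_of_forall_notMem fun y hy => h y hy.1 hy.2
    have hi₁ := hY.inter h𝒩 hr₁
    have hr₂' := hr₂.mono (inter_subset_left (s := Y) (t := G₁))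
    have hs₁ : Y ∩ G₁ ∩ G₂ ⊆ Y := inter_subset_left.trans inter_subset_left
    have hs₂ : (Y ∩ G₁) \ G₂ ⊆ Y := sdiff_subset.trans inter_subset_left
    refine HasFiltration.split ho₁ (HasFiltration.split ho₂ ?_ ?_) ?_
    · refine step _ hs₁ (hi₁.inter h𝒩 hr₂') (Or.inr (hdisj _ fun y hy h => ?_))
      exact ((hiff y hy.1.1).1 h).2 hy.2
    · refine step _ hs₂ (hi₁.diff h𝒩 hr₂') (Or.inl fun y hy => ?_)
      exact (hiff y hy.1.1).2 ⟨hy.1.2, hy.2⟩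
    · refine step _ sdiff_subset (hY.diff h𝒩 hr₁) (Or.inr (hdisj _ fun y hy h => ?_))
      exact hy.2 ((hiff y hy.1).1 h).1

end

/-! ### Slicing by a smooth function -/

section

variable {n : ℕ} {X W K Y : Set (Euc n)} {𝒩 : Set (Euc n × Euc n)} {f : Euc n → ℝ}
  {x : Euc n}

lemma NSmoothOn.continuousOn (hf : NSmoothOn 𝒩 f W) : ContinuousOn f W := by
  obtain ⟨df, -, hd, -⟩ := hf
  exact fun y hy => (hd y hy).continuousAt.continuousWithinAt

lemma NSmoothOn.locNOpen (hX : IsOpen X) (h𝒩 : IsConeFam X 𝒩) (hW : IsOpen W) (hWX : W ⊆ X)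
    (hf : NSmoothOn 𝒩 f W) (hx : x ∈ W) (c : ℝ) : LocNOpen X 𝒩 x {y | f y < c} := by
  obtain ⟨df, hc, hd, hneg⟩ := hf
  have hWx := hW.mem_nhds hx
  exact locNOpen_sublevel hX h𝒩 (hWX hx) (Filter.mem_of_superset hWx hd) (hc.continuousAt hWx)
    (hneg x hx) c

/-- Adding `‖· - x‖²` to a smooth function keeps it smooth near `x`. -/
lemma NSmoothOn.exists_locNOpen_add_sq (hX : IsOpen X) (h𝒩 : IsConeFam X 𝒩) (hW : IsOpen W)
    (hWX : W ⊆ X) (hf : NSmoothOn 𝒩 f W) (hx : x ∈ W) :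
    ∃ O, IsOpen O ∧ x ∈ O ∧ ∀ y ∈ O, ∀ c, LocNOpen X 𝒩 y {z | f z + ‖z - x‖ ^ 2 < c} := by
  obtain ⟨df, hc, hd, hneg⟩ := hf
  set dg : Euc n → (Euc n →L[ℝ] ℝ) := fun y => df y + 2 • innerSL ℝ (y - x) with hdg
  have hgd : ∀ y ∈ W, HasFDerivAt (fun z => f z + ‖z - x‖ ^ 2) (dg y) y := fun y hy =>
    (hd y hy).add ((hasFDerivAt_id y).sub_const x).norm_sq
  have hgc : ContinuousOn dg W := hc.add (by fun_prop)
  have hx0 : ∀ τ ∈ coneFiber 𝒩 x \ {0}, dg x τ < 0 := fun τ hτ => by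
    simpa [hdg] using hneg x hx τ hτ
  obtain ⟨O, hO, hOo, hxO⟩ := eventually_nhds_iff.1
    ((h𝒩.eventually_neg hX (hWX hx) (hgc.continuousAt (hW.mem_nhds hx)) hx0).and
      (hW.mem_nhds hx))
  refine ⟨O, hOo, hxO, fun y hy c => ?_⟩
  have hWy := hW.mem_nhds (hO y hy).2
  exact locNOpen_sublevel hX h𝒩 (hWX (hO y hy).2) (Filter.mem_of_superset hWy hgd)
    (hgc.continuousAt hWy) (hO y hy).1 c

lemma relNOpen_cap {r c : ℝ} (hr : 0 < r)
    (hcap : ∀ y ∈ Metric.ball x r, ∀ c, LocNOpen X 𝒩 y {z | f z + ‖z - x‖ ^ 2 < c})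
    (hY : ∀ y ∈ Y, c ≤ f y) (hloc : ∀ y ∈ closure Y, LocNOpen X 𝒩 y ∅) :
    RelNOpen X 𝒩 Y (Metric.ball x r ∩ {z | f z + ‖z - x‖ ^ 2 < c + r ^ 2 / 2}) := by
  intro y hy
  by_cases hyr : y ∈ Metric.ball x r
  · refine ⟨_, hcap y hyr (c + r ^ 2 / 2), ?_⟩
    filter_upwards [Metric.isOpen_ball.mem_nhds hyr] with z hz _
    simp only [mem_inter_iff, mem_ofPred_eq, hz, true_and]
  · refine ⟨∅, hloc y hy, ?_⟩
    have hyr' : r ≤ ‖y - x‖ := by simpa [dist_eq_norm] using hyr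
    have hlt : r ^ 2 / 2 < ‖y - x‖ ^ 2 := by nlinarith
    have hcont : Continuous fun z : Euc n => ‖z - x‖ ^ 2 := by fun_prop
    filter_upwards [hcont.continuousAt.eventually_const_lt hlt] with z hz hzY
    simp only [mem_empty_iff_false, false_iff, mem_inter_iff, mem_ofPred_eq, not_and, not_lt]
    intro _
    linarith [hY z hzY]

lemma closure_inter_cap_subset {r c : ℝ} (hr : 0 < r) (hY : ∀ y ∈ Y, c ≤ f y) :
    closure (Y ∩ (Metric.ball x r ∩ {z | f z + ‖z - x‖ ^ 2 < c + r ^ 2 / 2})) ⊆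
      Metric.ball x r := by
  have hcl : IsClosed {z : Euc n | ‖z - x‖ ^ 2 ≤ r ^ 2 / 2} :=
    isClosed_le (by fun_prop) continuous_const
  refine (closure_minimal (fun z hz => ?_) hcl).trans fun z hz => ?_
  · have h1 := hY z hz.1
    have h2 : f z + ‖z - x‖ ^ 2 < c + r ^ 2 / 2 := hz.2.2
    rw [mem_ofPred_eq]
    linarith
  · rw [mem_ofPred_eq] at hz
    rw [mem_ball_iff_norm]
    nlinarith

/-- A thin slice `{c ≤ f < c + ε}` covered by small balls can be filtered, provided that sets
supported in the balls can be. -/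
lemma hasFiltration_of_slice {Q : Set (Euc n) → Prop} {r : Euc n → ℝ} {c ε : ℝ}
    (h𝒩 : IsConeFam X 𝒩) (hfK : ContinuousOn f W) (hloc : ∀ y ∈ K, LocNOpen X 𝒩 y ∅)
    (hK : IsClosed K) (t : Finset (Euc n)) (hr : ∀ x ∈ t, 0 < r x)
    (hε : ∀ x ∈ t, ε ≤ r x ^ 2 / 4) (hrW : ∀ x ∈ t, Metric.ball x (r x) ⊆ W)
    (hcap : ∀ x ∈ t, ∀ y ∈ Metric.ball x (r x), ∀ c,
      LocNOpen X 𝒩 y {z | f z + ‖z - x‖ ^ 2 < c})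
    (hball : ∀ x ∈ t, ∀ Y, Admissible X 𝒩 K Y → closure Y ⊆ Metric.ball x (r x) →
      HasFiltration Q Y) :
    ∀ Y, Admissible X 𝒩 K Y → (∀ y ∈ Y, c ≤ f y ∧ f y < c + ε) →
      (∀ y ∈ Y, ∃ x ∈ t, y ∈ Metric.ball x (r x / 2)) → HasFiltration Q Y := by
  classical
  induction t using Finset.induction_on with
  | empty =>
    intro Y _ _ hcov
    have : Y = ∅ := eq_empty_of_forall_notMem fun y hy => by simpa using hcov y hy
    exact this ▸ hasFiltration_empty Q
  | insert x t _ ih =>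
    intro Y hY hs hcov
    simp only [Finset.mem_insert, forall_eq_or_imp] at hr hε hrW hcap hball
    have hlow : ∀ y ∈ Y, c ≤ f y := fun y hy => (hs y hy).1
    have hrel := relNOpen_cap hr.1 hcap.1 hlow fun y hy =>
      hloc y (closure_minimal hY.1 hK hy)
    have hopen : IsOpen (Metric.ball x (r x) ∩ {z | f z + ‖z - x‖ ^ 2 < c + r x ^ 2 / 2}) := by
      have hcont : ContinuousOn (fun z => f z + ‖z - x‖ ^ 2) (Metric.ball x (r x)) :=
        (hfK.mono hrW.1).add (by fun_prop)
      exact hcont.isOpen_inter_preimage Metric.isOpen_ball isOpen_Iio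
    refine HasFiltration.split hopen ?_ ?_
    · exact hball.1 _ (hY.inter h𝒩 hrel) (closure_inter_cap_subset hr.1 hlow)
    · refine ih hr.2 hε.2 hrW.2 hcap.2 hball.2 _ (hY.diff h𝒩 hrel)
        (fun y hy => hs y hy.1) fun y hy => ?_
      obtain ⟨x', hx', hyx'⟩ := hcov y hy.1
      rcases Finset.mem_insert.1 hx' with rfl | hx't
      · refine absurd ⟨?_, ?_⟩ hy.2
        · exact Metric.ball_subset_ball (by linarith [hr.1]) hyx'
        · have h1 := (hs y hy.1).2
          have h2 := hε.1
          rw [mem_ball_iff_norm] at hyx'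
          rw [mem_ofPred_eq]
          nlinarith [norm_nonneg (y - x')]
      · exact ⟨x', hx't, hyx'⟩

/-- If thin slices of `f` can be filtered, then so can sets on which `f` is bounded. -/
lemma hasFiltration_of_slices {Q : Set (Euc n) → Prop} {a ε : ℝ} (h𝒩 : IsConeFam X 𝒩)
    (hK : IsClosed K) (hKW : K ⊆ W) (hW : IsOpen W) (hfW : ContinuousOn f W)
    (hloc : ∀ y ∈ W, ∀ c, LocNOpen X 𝒩 y {z | f z < c})
    (hslice : ∀ c Y, Admissible X 𝒩 K Y → (∀ y ∈ Y, c ≤ f y ∧ f y < c + ε) →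
      HasFiltration Q Y) (m : ℕ) :
    ∀ Y, Admissible X 𝒩 K Y → (∀ y ∈ Y, a ≤ f y ∧ f y < a + m * ε) → HasFiltration Q Y := by
  induction m with
  | zero =>
    intro Y _ hs
    have : Y = ∅ := eq_empty_of_forall_notMem fun y hy => by
      have := hs y hy
      simp only [Nat.cast_zero, zero_mul, add_zero] at this
      linarith
    exact this ▸ hasFiltration_empty Q
  | succ m ih =>
    intro Y hY hs
    have hrel : RelNOpen X 𝒩 Y (W ∩ {z | f z < a + m * ε}) := fun y hy => by
      have hyW := hKW (closure_minimal hY.1 hK hy)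
      refine ⟨_, hloc y hyW (a + m * ε), ?_⟩
      filter_upwards [hW.mem_nhds hyW] with z hz _
      simp only [mem_inter_iff, mem_ofPred_eq, hz, true_and]
    refine HasFiltration.split (G := W ∩ {z | f z < a + m * ε})
      (hfW.isOpen_inter_preimage hW isOpen_Iio) ?_ ?_
    · exact ih _ (hY.inter h𝒩 hrel) fun y hy => ⟨(hs y hy.1).1, hy.2.2⟩
    · refine hslice (a + m * ε) _ (hY.diff h𝒩 hrel) fun y hy => ⟨?_, ?_⟩
      · by_contra h
        exact hy.2 ⟨hKW (hY.1 hy.1), not_le.1 h⟩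
      · have := (hs y hy.1).2
        push_cast at this
        linarith

/-- Near each point, finitely many special sets are simultaneously differences of open sets. -/
lemma exists_splitsOn_forall {ι : Type*} [Finite ι] {A : ι → Set (Euc n)} (hW : IsOpen W)
    (hWX : W ⊆ X) (hloc : ∀ y ∈ W, LocNOpen X 𝒩 y ∅) (hA : ∀ i, NSpecial X 𝒩 (A i))
    (hx : x ∈ W) : ∃ O, IsOpen O ∧ x ∈ O ∧ ∀ i, SplitsOn X 𝒩 O (A i) := by
  have h : ∀ i, ∃ O, IsOpen O ∧ x ∈ O ∧ SplitsOn X 𝒩 O (A i) := fun i => by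
    by_cases hxi : x ∈ closure (A i)
    · exact ((hA i).locSpecial ⟨hxi, hWX hx⟩).exists_splitsOn
    · exact ⟨W ∩ (closure (A i))ᶜ, hW.inter isClosed_closure.isOpen_compl, ⟨hx, hxi⟩,
        SplitsOn.of_disjoint (fun y hy h => hy.2 (subset_closure h)) fun y hy => hloc y hy.1⟩
  choose O hO hxO hs using h
  exact ⟨⋂ i, O i, isOpen_iInter_of_finite hO, mem_iInter.2 hxO,
    fun i => (hs i).mono (iInter_subset O i)⟩

end

/-- refinement of STATEMENT 17 compatible with finitely many further
`𝒩`-lenses. -/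
theorem stmt_18 {n : ℕ} (X : Set (Euc n)) (hX : IsOpen X)
    (𝒩 : Set (Euc n × Euc n)) (h𝒩 : IsConeFam X 𝒩)
    (Z : Set (Euc n)) (hZ : NLens X 𝒩 Z)
    (𝒰 : Set (Set (Euc n))) (h𝒰o : ∀ U ∈ 𝒰, IsOpen U) (h𝒰X : ∀ U ∈ 𝒰, U ⊆ X)
    (hcov : closure Z ∩ X ⊆ ⋃₀ 𝒰)
    (k : ℕ) (Z' : Fin k → Set (Euc n)) (hZ' : ∀ i, NLens X 𝒩 (Z' i)) :
    ∃ Ps : Set (Set (Euc n)), NSpecialPartition X 𝒩 Z Ps ∧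
      (∀ A ∈ Ps, ∃ U ∈ 𝒰, A ⊆ U) ∧
      ∀ i : Fin k, ∀ A ∈ Ps, A ⊆ Z' i ∨ A ∩ Z' i = ∅ := by
  classical
  obtain ⟨W, f, hW, hKW, hWX, hf⟩ := hZ.2.2
  set K := closure Z ∩ X with hKdef
  have hK : IsCompact K := hZ.2.1
  have hKX : K ⊆ X := inter_subset_right
  have hlocf : ∀ y ∈ W, ∀ c, LocNOpen X 𝒩 y {z | f z < c} := fun y hy =>
    hf.locNOpen hX h𝒩 hW hWX hy
  have hloc0 : ∀ y ∈ W, LocNOpen X 𝒩 y ∅ := fun y hy => (hlocf y hy 0).empty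
  set Q : Set (Euc n) → Prop := fun A => NLens X 𝒩 A ∧ (∃ U ∈ 𝒰, A ⊆ U) ∧
    ∀ i, A ⊆ Z' i ∨ A ∩ Z' i = ∅ with hQ
  have hZadm : Admissible X 𝒩 K Z := by
    have hZK : Z ⊆ K := fun z hz => ⟨subset_closure hz, hZ.1.1 hz⟩
    exact ⟨hZK, fun x hx => hZ.1.locSpecial (closure_minimal hZK hK.isClosed hx)⟩
  have hpt : ∀ x ∈ K, ∃ r > 0, Metric.ball x r ⊆ W ∧
      (∀ y ∈ Metric.ball x r, ∀ c, LocNOpen X 𝒩 y {z | f z + ‖z - x‖ ^ 2 < c}) ∧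
      ∀ Y, Admissible X 𝒩 K Y → closure Y ⊆ Metric.ball x r → HasFiltration Q Y := by
    intro x hx
    obtain ⟨U, hU, hxU⟩ := hcov hx
    obtain ⟨O₁, hO₁, hxO₁, hcap⟩ := hf.exists_locNOpen_add_sq hX h𝒩 hW hWX (hKW hx)
    obtain ⟨O₂, hO₂, hxO₂, hspl⟩ :=
      exists_splitsOn_forall hW hWX hloc0 (fun i => (hZ' i).1) (hKW hx)
    obtain ⟨r, hr, hball⟩ := Metric.isOpen_iff.1
      ((hW.inter (h𝒰o U hU)).inter (hO₁.inter hO₂)) x ⟨⟨hKW hx, hxU⟩, hxO₁, hxO₂⟩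
    refine ⟨r, hr, fun y hy => (hball hy).1.1, fun y hy => hcap y (hball hy).2.1,
      fun Y hY hYr => ?_⟩
    refine hasFiltration_of_splitsOn (O := Metric.ball x r) h𝒩
      (fun i => (hspl i).mono fun y hy => (hball hy).2.2) (fun A hA hAr hAi => ?_)
      Finset.univ Y hY hYr (by simp)
    exact ⟨hA.nLens hK hKX hZ.2.2,
      ⟨U, hU, fun y hy => (hball (hAr (subset_closure hy))).1.2⟩, hAi⟩
  choose! r hr hrW hcap hfil using hpt
  obtain ⟨t, htK, hcovt⟩ := hK.elim_nhds_subcover (fun x => Metric.ball x (r x / 2))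
    fun x hx => Metric.ball_mem_nhds x (half_pos (hr x hx))
  obtain ⟨ε, hε, hεt⟩ : ∃ ε > 0, ∀ x ∈ t, ε ≤ r x ^ 2 / 4 := by
    rcases t.eq_empty_or_nonempty with rfl | hne
    · exact ⟨1, one_pos, by simp⟩
    · obtain ⟨x₀, hx₀, hmin⟩ := t.exists_min_image (fun x => r x ^ 2 / 4) hne
      exact ⟨r x₀ ^ 2 / 4, by have := hr x₀ (htK x₀ hx₀); positivity, hmin⟩
  have hcont : ContinuousOn f K := hf.continuousOn.mono hKW
  obtain ⟨a, ha⟩ := (hK.image_of_continuousOn hcont).bddBelow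
  obtain ⟨b, hb⟩ := (hK.image_of_continuousOn hcont).bddAbove
  obtain ⟨m, hm⟩ := exists_nat_gt ((b - a) / ε)
  rw [div_lt_iff₀ hε] at hm
  have hfin : HasFiltration Q Z := by
    refine hasFiltration_of_slices (a := a) (ε := ε) h𝒩 hK.isClosed hKW hW hf.continuousOn
      hlocf (fun c Y hY hs => ?_) m Z hZadm fun y hy => ⟨?_, ?_⟩
    · refine hasFiltration_of_slice h𝒩 hf.continuousOn (fun y hy => hloc0 y (hKW hy))
        hK.isClosed t (fun x hx => hr x (htK x hx)) hεt (fun x hx => hrW x (htK x hx))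
        (fun x hx => hcap x (htK x hx)) (fun x hx => hfil x (htK x hx)) Y hY hs fun y hy => ?_
      simpa using hcovt (hY.1 hy)
    · exact ha (mem_image_of_mem f (hZadm.1 hy))
    · have := hb (mem_image_of_mem f (hZadm.1 hy))
      linarith
  obtain ⟨Ps, hP, hF, hPQ⟩ := hfin
  exact ⟨Ps, ⟨hP, hF, fun A hA => (hPQ A hA).1⟩, fun A hA => (hPQ A hA).2.1,
    fun i A hA => (hPQ A hA).2.2 i⟩
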